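/- arXiv:2007.13864 — 3 statements merged into one kernel-verified Lean document; each statement's English description precedes it below -/
import Mathlib

section
/- Let χ be a child distribution with finite m-th moment (m ≥ 1) and let h be a threshold function. Then the automaton distribution map Ψ of (χ,h) is m times differentiable at 0 (within [0,1]) and Ψ^{(m)}(0) = Σ_{ℓ=m}^{∞} (−1)^{m+h(ℓ)} · C(m−1, h(ℓ)−1) · χ(ℓ) · (ℓ)_m, where C(m−1, j−1) = 0 when j−1 > m−1. -/
/-- `B≥_{n,k}(x) = Σ_{j=k}^{n} C(n,j)·x^j·(1−x)^{n−j}`. -/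
noncomputable def Bge (n k : ℕ) (x : ℝ) : ℝ :=
  ∑ j ∈ Finset.Icc k n, (n.choose j : ℝ) * x ^ j * (1 - x) ^ (n - j)

/-- A child distribution: nonnegative, summable, total mass one. -/
def IsChildDist (χ : ℕ → ℝ) : Prop :=
  (∀ n, 0 ≤ χ n) ∧ Summable χ ∧ (∑' n, χ n) = 1

/-- The automaton distribution map of a recursive tree system `(χ, h)`. -/
noncomputable def Psi (χ : ℕ → ℝ) (h : ℕ → ℕ) (x : ℝ) : ℝ :=
  ∑' n, χ n * Bge n (h n) x

open Filter Topology

lemma Bge_zero_right (n : ℕ) (x : ℝ) : Bge n 0 x = 1 := by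
  have h := add_pow x (1 - x) n
  rw [add_sub_cancel, one_pow] at h
  rw [h, Bge, Finset.range_eq_Ico, ← Finset.Ico_add_one_right_eq_Icc]
  exact Finset.sum_congr rfl fun j _ => by ring

lemma Bge_eq_zero_of_lt {n k : ℕ} (hk : n < k) (x : ℝ) : Bge n k x = 0 := by
  simp [Bge, Finset.Icc_eq_empty_of_lt hk]

lemma Bge_eq_add_Bge_succ (n k : ℕ) (x : ℝ) :
    Bge n k x = (n.choose k : ℝ) * x ^ k * (1 - x) ^ (n - k) + Bge n (k + 1) x := by
  rcases le_or_gt k n with hk | hk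
  · rw [Bge, Bge, ← Finset.insert_Icc_add_one_left_eq_Icc hk, Finset.sum_insert (by simp)]
  · rw [Bge_eq_zero_of_lt hk, Bge_eq_zero_of_lt (by omega), Nat.choose_eq_zero_of_lt hk]
    simp

/-- Conditioning on one of the `n + 1` trials. -/
lemma Bge_succ_succ (n k : ℕ) (x : ℝ) :
    Bge (n + 1) (k + 1) x = x * Bge n k x + (1 - x) * Bge n (k + 1) x := by
  induction k with
  | zero =>
    have h₁ := Bge_eq_add_Bge_succ (n + 1) 0 x
    have h₂ := Bge_eq_add_Bge_succ n 0 x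
    simp only [Bge_zero_right, Nat.choose_zero_right, Nat.sub_zero, pow_succ] at h₁ h₂ ⊢
    push_cast at h₁ h₂
    linear_combination (1 - x) * h₂ - h₁
  | succ k ih =>
    have h₁ := Bge_eq_add_Bge_succ (n + 1) (k + 1) x
    have h₂ := Bge_eq_add_Bge_succ n k x
    have h₃ := Bge_eq_add_Bge_succ n (k + 1) x
    have h₄ : ((n + 1).choose (k + 1) : ℝ) * x ^ (k + 1) * (1 - x) ^ (n + 1 - (k + 1)) =
        x * ((n.choose k : ℝ) * x ^ k * (1 - x) ^ (n - k)) +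
          (1 - x) * ((n.choose (k + 1) : ℝ) * x ^ (k + 1) * (1 - x) ^ (n - (k + 1))) := by
      rw [Nat.choose_succ_succ, Nat.add_sub_add_right]
      rcases le_or_gt (k + 1) n with hk | hk
      · obtain ⟨d, rfl⟩ := Nat.exists_eq_add_of_le hk
        rw [show k + 1 + d - k = d + 1 by omega, show k + 1 + d - (k + 1) = d by omega]
        push_cast
        ring
      · rw [Nat.choose_eq_zero_of_lt hk]
        push_cast
        ring
    linear_combination ih - h₁ + x * h₂ + (1 - x) * h₃ - h₄

lemma Bge_mem_Icc (n k : ℕ) {x : ℝ} (hx : x ∈ Set.Icc (0 : ℝ) 1) :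
    Bge n k x ∈ Set.Icc (0 : ℝ) 1 := by
  induction n generalizing k with
  | zero =>
    cases k with
    | zero => simp [Bge_zero_right]
    | succ k => simp [Bge_eq_zero_of_lt]
  | succ n ih =>
    cases k with
    | zero => simp [Bge_zero_right]
    | succ k =>
      rw [Bge_succ_succ]
      exact convex_Icc (0 : ℝ) 1 (ih k) (ih (k + 1)) hx.1 (sub_nonneg.2 hx.2) (by ring)

lemma hasDerivAt_Bge (n k : ℕ) (x : ℝ) :
    HasDerivAt (Bge n k) (n * (Bge (n - 1) (k - 1) x - Bge (n - 1) k x)) x := by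
  induction n generalizing k with
  | zero =>
    have h : Bge 0 k = fun _ => Bge 0 k 0 := by
      funext y
      cases k with
      | zero => simp [Bge_zero_right]
      | succ k => simp [Bge_eq_zero_of_lt]
    rw [h]
    simpa using hasDerivAt_const x (Bge 0 k 0)
  | succ n ih =>
    cases k with
    | zero =>
      rw [show Bge (n + 1) 0 = fun _ => 1 from funext (Bge_zero_right _)]
      simpa using hasDerivAt_const x (1 : ℝ)
    | succ k =>
      rw [show Bge (n + 1) (k + 1) = fun y => y * Bge n k y + (1 - y) * Bge n (k + 1) y from
        funext (Bge_succ_succ n k)]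
      have h := ((hasDerivAt_id x).mul (ih k)).add
        (((hasDerivAt_id x).const_sub 1).mul (ih (k + 1)))
      refine h.congr_deriv ?_
      simp only [id, Nat.add_sub_cancel]
      cases n with
      | zero => simp; ring
      | succ n =>
        rw [Nat.add_sub_cancel, Bge_succ_succ n k]
        cases k with
        | zero =>
          simp only [Nat.zero_sub, Bge_zero_right]
          push_cast
          ring
        | succ k =>
          rw [Nat.add_sub_cancel, Bge_succ_succ n k]
          push_cast
          ring

/-- The `j`-th derivative of `Bge n k`. -/
noncomputable def BgeDeriv : ℕ → ℕ → ℕ → ℝ → ℝ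
  | 0, n, k, x => Bge n k x
  | j + 1, n, k, x => n * (BgeDeriv j (n - 1) (k - 1) x - BgeDeriv j (n - 1) k x)

lemma hasDerivAt_BgeDeriv (j n k : ℕ) (x : ℝ) :
    HasDerivAt (BgeDeriv j n k) (BgeDeriv (j + 1) n k x) x := by
  induction j generalizing n k with
  | zero => exact hasDerivAt_Bge n k x
  | succ j ih => exact ((ih (n - 1) (k - 1)).sub (ih (n - 1) k)).const_mul (n : ℝ)

lemma abs_BgeDeriv_le (j n k : ℕ) {x : ℝ} (hx : x ∈ Set.Icc (0 : ℝ) 1) :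
    |BgeDeriv j n k x| ≤ 2 ^ j * (n : ℝ) ^ j := by
  induction j generalizing n k with
  | zero =>
    have h := Bge_mem_Icc n k hx
    simpa [BgeDeriv, abs_of_nonneg h.1] using h.2
  | succ j ih =>
    have hn : ((n - 1 : ℕ) : ℝ) ^ j ≤ (n : ℝ) ^ j := by
      gcongr
      exact Nat.sub_le n 1
    have hk (i : ℕ) : |BgeDeriv j (n - 1) i x| ≤ 2 ^ j * (n : ℝ) ^ j :=
      (ih (n - 1) i).trans (by gcongr)
    rw [BgeDeriv, abs_mul, Nat.abs_cast]
    calc (n : ℝ) * |BgeDeriv j (n - 1) (k - 1) x - BgeDeriv j (n - 1) k x|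
        ≤ n * (2 ^ j * (n : ℝ) ^ j + 2 ^ j * (n : ℝ) ^ j) := by
          gcongr
          exact (abs_sub _ _).trans (add_le_add (hk _) (hk _))
      _ = 2 ^ (j + 1) * (n : ℝ) ^ (j + 1) := by ring

lemma Bge_succ_apply_zero (n k : ℕ) : Bge n (k + 1) 0 = 0 := by
  refine Finset.sum_eq_zero fun j hj => ?_
  have : j ≠ 0 := by
    have := (Finset.mem_Icc.1 hj).1
    omega
  simp [this]

lemma BgeDeriv_succ_zero (j n : ℕ) (x : ℝ) : BgeDeriv (j + 1) n 0 x = 0 := by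
  simp [BgeDeriv]

lemma BgeDeriv_succ_succ_apply_zero (j n k : ℕ) :
    BgeDeriv (j + 1) n (k + 1) 0 = (-1) ^ (j + k) * (j.choose k : ℝ) * n.descFactorial (j + 1) := by
  induction j generalizing n k with
  | zero =>
    cases k with
    | zero => simp [BgeDeriv, Bge_zero_right, Bge_succ_apply_zero]
    | succ k => simp [BgeDeriv, Bge_succ_apply_zero]
  | succ j ih =>
    have hd : (n.descFactorial (j + 1 + 1) : ℝ) = n * (n - 1).descFactorial (j + 1) := by
      cases n with
      | zero => simp
      | succ n => rw [Nat.succ_descFactorial_succ]; simp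
    rw [BgeDeriv, Nat.add_sub_cancel, ih, hd]
    cases k with
    | zero =>
      rw [BgeDeriv_succ_zero]
      simp only [Nat.choose_zero_right]
      push_cast
      ring
    | succ k =>
      rw [ih, Nat.choose_succ_succ]
      push_cast
      ring

/-- The `j`-th derivative of `Psi χ h` on `[0, 1]`. -/
noncomputable def PsiDeriv (χ : ℕ → ℝ) (h : ℕ → ℕ) (j : ℕ) (x : ℝ) : ℝ :=
  ∑' n, χ n * BgeDeriv j n (h n) x

lemma summable_moment_of_le {χ : ℕ → ℝ} (hχ : ∀ n, 0 ≤ χ n) (hs : Summable χ) {j m : ℕ}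
    (hjm : j ≤ m) (hmom : Summable fun n => χ n * (n : ℝ) ^ m) :
    Summable fun n => χ n * (n : ℝ) ^ j := by
  refine (hs.add hmom).of_nonneg_of_le (fun n => mul_nonneg (hχ n) (by positivity)) fun n => ?_
  have h : (n : ℝ) ^ j ≤ 1 + (n : ℝ) ^ m := by
    rcases Nat.eq_zero_or_pos n with rfl | hn
    · rcases j with - | j
      · simp
      · simp; positivity
    · have := pow_le_pow_right₀ (Nat.one_le_cast.2 hn : (1 : ℝ) ≤ n) hjm
      linarith
  calc χ n * (n : ℝ) ^ j ≤ χ n * (1 + (n : ℝ) ^ m) := mul_le_mul_of_nonneg_left h (hχ n)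
    _ = χ n + χ n * (n : ℝ) ^ m := by ring

lemma norm_mul_BgeDeriv_le {c : ℝ} (hc : 0 ≤ c) (j n k : ℕ) {x : ℝ}
    (hx : x ∈ Set.Icc (0 : ℝ) 1) :
    ‖c * BgeDeriv j n k x‖ ≤ 2 ^ j * (c * (n : ℝ) ^ j) := by
  rw [norm_mul, Real.norm_of_nonneg hc, Real.norm_eq_abs]
  calc c * |BgeDeriv j n k x| ≤ c * (2 ^ j * (n : ℝ) ^ j) :=
        mul_le_mul_of_nonneg_left (abs_BgeDeriv_le j n k hx) hc
    _ = 2 ^ j * (c * (n : ℝ) ^ j) := by ring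

lemma continuousOn_PsiDeriv {χ : ℕ → ℝ} (h : ℕ → ℕ) (hχ : ∀ n, 0 ≤ χ n) {j : ℕ}
    (hmom : Summable fun n => χ n * (n : ℝ) ^ j) :
    ContinuousOn (PsiDeriv χ h j) (Set.Icc 0 1) :=
  continuousOn_tsum
    (fun n => (continuous_iff_continuousAt.2 fun x =>
      ((hasDerivAt_BgeDeriv j n (h n) x).const_mul (χ n)).continuousAt).continuousOn)
    (hmom.mul_left (2 ^ j)) fun n _ hx => norm_mul_BgeDeriv_le (hχ n) j n (h n) hx

lemma hasDerivWithinAt_PsiDeriv {χ : ℕ → ℝ} (h : ℕ → ℕ) (hχ : ∀ n, 0 ≤ χ n) {j : ℕ}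
    (hj : Summable fun n => χ n * (n : ℝ) ^ j)
    (hj' : Summable fun n => χ n * (n : ℝ) ^ (j + 1)) {x : ℝ} (hx : x ∈ Set.Icc (0 : ℝ) 1) :
    HasDerivWithinAt (PsiDeriv χ h j) (PsiDeriv χ h (j + 1) x) (Set.Icc 0 1) x := by
  have hs {y : ℝ} (hy : y ∈ Set.Icc (0 : ℝ) 1) : Summable fun n => χ n * BgeDeriv j n (h n) y :=
    (hj.mul_left (2 ^ j)).of_norm_bounded fun n => norm_mul_BgeDeriv_le (hχ n) j n (h n) hy
  have hd (n : ℕ) (y : ℝ) : HasDerivAt (fun z => χ n * BgeDeriv j n (h n) z)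
      (χ n * BgeDeriv (j + 1) n (h n) y) y :=
    (hasDerivAt_BgeDeriv j n (h n) y).const_mul (χ n)
  rw [hasDerivWithinAt_iff_tendsto_slope]
  have key : Tendsto (fun y => ∑' n, slope (fun z => χ n * BgeDeriv j n (h n) z) x y)
      (𝓝[Set.Icc 0 1 \ {x}] x) (𝓝 (PsiDeriv χ h (j + 1) x)) := by
    refine tendsto_tsum_of_dominated_convergence (hj'.mul_left (2 ^ (j + 1)))
      (fun n => hasDerivWithinAt_iff_tendsto_slope.1 (hd n x).hasDerivWithinAt) ?_
    filter_upwards [self_mem_nhdsWithin] with y hy n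
    have hle := (convex_Icc (0 : ℝ) 1).norm_image_sub_le_of_norm_hasDerivWithin_le
      (fun z _ => (hd n z).hasDerivWithinAt)
      (fun z hz => norm_mul_BgeDeriv_le (hχ n) (j + 1) n (h n) hz) hx hy.1
    have hpos : 0 < ‖y - x‖ := norm_pos_iff.2 (sub_ne_zero.2 hy.2)
    rw [slope_def_field, norm_div, div_le_iff₀ hpos]
    exact hle
  refine key.congr' ?_
  filter_upwards [self_mem_nhdsWithin] with y hy
  simp only [slope_def_field, PsiDeriv]
  rw [tsum_div_const, (hs hy.1).tsum_sub (hs hx)]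

lemma iteratedDerivWithin_Psi {χ : ℕ → ℝ} (h : ℕ → ℕ) (hχ : ∀ n, 0 ≤ χ n) (hs : Summable χ)
    {m : ℕ} (hmom : Summable fun n => χ n * (n : ℝ) ^ m) {j : ℕ} (hjm : j ≤ m) :
    Set.EqOn (iteratedDerivWithin j (Psi χ h) (Set.Icc 0 1)) (PsiDeriv χ h j) (Set.Icc 0 1) := by
  induction j with
  | zero => intro x _; rfl
  | succ j ih =>
    intro x hx
    rw [iteratedDerivWithin_succ,
      derivWithin_congr (ih (Nat.le_of_succ_le hjm)) (ih (Nat.le_of_succ_le hjm) hx)]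
    exact (hasDerivWithinAt_PsiDeriv h hχ
      (summable_moment_of_le hχ hs (Nat.le_of_succ_le hjm) hmom)
      (summable_moment_of_le hχ hs hjm hmom) hx).derivWithin (uniqueDiffOn_Icc_zero_one x hx)

lemma contDiffOn_Psi {χ : ℕ → ℝ} (h : ℕ → ℕ) (hχ : ∀ n, 0 ≤ χ n) (hs : Summable χ)
    {m : ℕ} (hmom : Summable fun n => χ n * (n : ℝ) ^ m) :
    ContDiffOn ℝ (m : ℕ∞) (Psi χ h) (Set.Icc 0 1) := by
  refine contDiffOn_of_continuousOn_differentiableOn_deriv (fun j hj => ?_) fun j hj => ?_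
  · have hj : j ≤ m := by exact_mod_cast hj
    exact (continuousOn_PsiDeriv h hχ (summable_moment_of_le hχ hs hj hmom)).congr
      (iteratedDerivWithin_Psi h hχ hs hmom hj)
  · have hj : j < m := by exact_mod_cast hj
    have hdiff : DifferentiableOn ℝ (PsiDeriv χ h j) (Set.Icc 0 1) := fun x hx =>
      (hasDerivWithinAt_PsiDeriv h hχ (summable_moment_of_le hχ hs hj.le hmom)
        (summable_moment_of_le hχ hs hj hmom) hx).differentiableWithinAt
    exact hdiff.congr (iteratedDerivWithin_Psi h hχ hs hmom hj.le)

theorem stmt4 (m : ℕ) (hm : 1 ≤ m) (χ : ℕ → ℝ) (h : ℕ → ℕ)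
    (hχ : IsChildDist χ)
    (hmom : Summable fun n => χ n * (n : ℝ) ^ m)
    (hh : ∀ n, 1 ≤ h n) :
    ContDiffWithinAt ℝ (m : ℕ∞) (Psi χ h) (Set.Icc (0 : ℝ) 1) 0 ∧
    iteratedDerivWithin m (Psi χ h) (Set.Icc (0 : ℝ) 1) 0 =
      ∑' n : ℕ, (-1 : ℝ) ^ (m + h n) * ((m - 1).choose (h n - 1) : ℝ) * χ n *
        (n.descFactorial m : ℝ) := by
  have h0 : (0 : ℝ) ∈ Set.Icc (0 : ℝ) 1 := by simp
  refine ⟨contDiffOn_Psi h hχ.1 hχ.2.1 hmom 0 h0, ?_⟩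
  rw [iteratedDerivWithin_Psi h hχ.1 hχ.2.1 hmom le_rfl h0, PsiDeriv]
  refine tsum_congr fun n => ?_
  obtain ⟨i, rfl⟩ := Nat.exists_eq_add_of_le' hm
  obtain ⟨k, hk⟩ := Nat.exists_eq_add_of_le' (hh n)
  rw [hk, BgeDeriv_succ_succ_apply_zero, Nat.add_sub_cancel, Nat.add_sub_cancel]
  ring
end

section
/- Let 1 ≤ ℓ_1 < ℓ_2 < ⋯ < ℓ_m be integers and let h be a threshold function with h(ℓ_k) = k for each k ∈ {1,…,m}. Then there exists exactly one child distribution χ supported within {0, ℓ_1, …, ℓ_m} such that the system (χ,h) is m-concordant; this measure is denoted crit(ℓ_1,…,ℓ_m). Moreover it satisfies χ(ℓ_1) = 1/ℓ_1 and, for 2 ≤ k ≤ m, χ(ℓ_k) = (1/(ℓ_k)_k) · Σ_{j=1}^{k−1} (−1)^{k+j+1} · C(k−1, j−1) · χ(ℓ_j) · (ℓ_j)_k. -/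
/-- `Ψ` is `m`-concordant: the first `m` derivatives of `Ψ` at `0` (within `[0,1]`)
match those of the identity, i.e. `Ψ'(0) = 1` and `Ψ^{(k)}(0) = 0` for `2 ≤ k ≤ m`.
(For `m = 0` the condition is vacuous.) -/
def Concordant (m : ℕ) (Ψ : ℝ → ℝ) : Prop :=
  (1 ≤ m → iteratedDerivWithin 1 Ψ (Set.Icc (0 : ℝ) 1) 0 = 1) ∧
  ∀ k, 2 ≤ k → k ≤ m → iteratedDerivWithin k Ψ (Set.Icc (0 : ℝ) 1) 0 = 0


open Polynomial

/-- The polynomial whose evaluation is `Bge n k`. -/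
noncomputable def bgePolynomial (n k : ℕ) : ℝ[X] :=
  ∑ j ∈ Finset.Icc k n, bernsteinPolynomial ℝ n j

theorem eval_bgePolynomial (n k : ℕ) (x : ℝ) : (bgePolynomial n k).eval x = Bge n k x := by
  simp [bgePolynomial, Bge, bernsteinPolynomial, eval_finsetSum]

theorem derivative_bgePolynomial_succ (n k : ℕ) :
    derivative (bgePolynomial n (k + 1)) = n * bernsteinPolynomial ℝ (n - 1) k := by
  rcases n with _ | n
  · simp [bgePolynomial]
  have hIcc : Finset.Icc (k + 1) (n + 1) = Finset.Ico (k + 1) (n + 1 + 1) := by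
    ext
    simp
  rw [bgePolynomial, hIcc, ← Finset.sum_Ico_add', derivative_sum]
  simp only [bernsteinPolynomial.derivative_succ, ← Finset.mul_sum]
  congr 1
  rw [Finset.sum_Ico_eq_sum_range]
  simp only [Nat.add_sub_cancel, add_assoc]
  rw [Finset.sum_range_sub' (fun i => bernsteinPolynomial ℝ n (k + i)),
    bernsteinPolynomial.eq_zero_of_lt ℝ (show n < k + (n + 1 - k) by omega)]
  simp

theorem coeff_one_sub_X_pow_eq (n k : ℕ) :
    ((1 - X : ℝ[X]) ^ n).coeff k = (-1) ^ k * (n.choose k : ℝ) := by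
  have : (1 - X : ℝ[X]) ^ n = ((1 + X) ^ n).comp (C (-1) * X) := by
    simp [sub_eq_add_neg]
  rw [this, comp_C_mul_X_coeff, coeff_one_add_X_pow, mul_comm]

theorem coeff_bernsteinPolynomial (n j k : ℕ) :
    (bernsteinPolynomial ℝ n j).coeff k =
      (-1) ^ (k + j) * (n.choose k : ℝ) * (k.choose j : ℝ) := by
  rw [bernsteinPolynomial, mul_assoc, ← C_eq_natCast, coeff_C_mul, coeff_X_pow_mul']
  split_ifs with hjk
  · have hc : (n.choose k : ℝ) * k.choose j = n.choose j * (n - j).choose (k - j) := by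
      exact_mod_cast Nat.choose_mul hjk
    obtain ⟨i, rfl⟩ := Nat.exists_eq_add_of_le hjk
    rw [coeff_one_sub_X_pow_eq, mul_assoc, hc, show j + i + j = i + 2 * j by ring, pow_add,
      pow_mul]
    simp only [Nat.add_sub_cancel_left]
    norm_num
    ring
  · rw [Nat.choose_eq_zero_of_lt (not_le.mp hjk)]
    simp

theorem factorial_mul_coeff_derivative_bgePolynomial (n j k : ℕ) :
    (k.factorial : ℝ) * (derivative (bgePolynomial n (j + 1))).coeff k =
      (-1) ^ (k + j) * (k.choose j : ℝ) * (n.descFactorial (k + 1) : ℝ) := by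
  rw [derivative_bgePolynomial_succ, ← C_eq_natCast, coeff_C_mul, coeff_bernsteinPolynomial]
  rcases n with _ | n
  · simp
  · rw [Nat.succ_descFactorial_succ, Nat.descFactorial_eq_factorial_mul_choose]
    push_cast
    ring

theorem iteratedDeriv_eval_polynomial (p : ℝ[X]) (k : ℕ) :
    iteratedDeriv k (fun x => p.eval x) = fun x => (derivative^[k] p).eval x := by
  induction k with
  | zero => simp
  | succ k ih =>
    rw [iteratedDeriv_succ, ih, Function.iterate_succ_apply']
    ext x
    simp

theorem iteratedDerivWithin_eval_polynomial_zero (p : ℝ[X]) (k : ℕ) :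
    iteratedDerivWithin (k + 1) (fun x => p.eval x) (Set.Icc (0 : ℝ) 1) 0 =
      (k.factorial : ℝ) * (derivative p).coeff k := by
  have hdiff : ContDiff ℝ (k + 1 : ℕ) fun x => p.eval x := by
    simpa using p.contDiff_aeval (𝕜 := ℝ) (k + 1 : ℕ)
  rw [iteratedDerivWithin_eq_iteratedDeriv (uniqueDiffOn_Icc zero_lt_one)
    hdiff.contDiffAt (by simp), iteratedDeriv_eval_polynomial, Function.iterate_succ_apply]
  dsimp only
  rw [← coeff_zero_eq_eval_zero, coeff_iterate_derivative]
  simp [Nat.descFactorial_self]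

theorem concordant_eval_iff (m : ℕ) (p : ℝ[X]) :
    Concordant m (fun x => p.eval x) ↔
      ∀ k < m, (k.factorial : ℝ) * (derivative p).coeff k = if k = 0 then 1 else 0 := by
  constructor
  · rintro ⟨h1, h2⟩ k hk
    rw [← iteratedDerivWithin_eval_polynomial_zero]
    rcases k with _ | k
    · simpa using h1 hk
    · simpa using h2 (k + 1 + 1) (by omega) (by omega)
  · refine fun H => ⟨fun hm => ?_, fun k hk hkm => ?_⟩
    · rw [iteratedDerivWithin_eval_polynomial_zero p 0]
      simpa using H 0 hm
    · obtain ⟨k, rfl⟩ := Nat.exists_eq_add_of_le' hk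
      simpa [← iteratedDerivWithin_eval_polynomial_zero] using H (k + 1) (by omega)

/-- Subtracting `f(1) X^d` from a polynomial of degree at most `d` with nonnegative coefficients
leaves `1 - X` times a polynomial of the same kind. -/
theorem exists_sub_eval_one_mul_X_pow (f : ℝ[X]) (d : ℕ) (hf : ∀ i, 0 ≤ f.coeff i)
    (hd : f.natDegree ≤ d) :
    ∃ g : ℝ[X], (∀ i, 0 ≤ g.coeff i) ∧ g.natDegree ≤ d ∧
      f = C (f.eval 1) * X ^ d + (1 - X) * g := by
  refine ⟨∑ i ∈ Finset.range (d + 1), C (f.coeff i) * ∑ r ∈ Finset.Ico i d, X ^ r, ?_, ?_, ?_⟩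
  · intro i
    simp only [finsetSum_coeff, coeff_C_mul, coeff_X_pow]
    refine Finset.sum_nonneg fun j _ => mul_nonneg (hf j) (Finset.sum_nonneg fun r _ => ?_)
    split_ifs <;> norm_num
  · refine natDegree_sum_le_of_forall_le _ _ fun i _ => (natDegree_C_mul_le _ _).trans ?_
    refine natDegree_sum_le_of_forall_le _ _ fun r hr => (natDegree_X_pow_le r).trans ?_
    exact (Finset.mem_Ico.mp hr).2.le
  · have hfs := as_sum_range' f (d + 1) (by omega)
    have hev : f.eval 1 = ∑ i ∈ Finset.range (d + 1), f.coeff i := by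
      simpa using eval_eq_sum_range' (show f.natDegree < d + 1 by omega) 1
    rw [hev, map_sum, Finset.sum_mul, Finset.mul_sum, ← Finset.sum_add_distrib]
    conv_lhs => rw [hfs]
    refine Finset.sum_congr rfl fun i hi => ?_
    have hg := geom_sum_Ico_mul_neg (X : ℝ[X]) (show i ≤ d by simpa [Nat.lt_succ_iff] using hi)
    rw [← C_mul_X_pow_eq_monomial]
    linear_combination (-C (f.coeff i)) * hg

/-- For nondecreasing exponents `d`, the constant `1` is expanded in the functions
`X ^ j * (1 - X) ^ d j` with nonnegative coefficients and a remainder `X ^ k * f (1 - X)`, where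
`f` has nonnegative coefficients. -/
theorem exists_nonneg_expansion (d : ℕ → ℕ) (m : ℕ)
    (hd : ∀ i j, i ≤ j → j < m → d i ≤ d j) (k : ℕ) (hk : k ≤ m) :
    ∃ (b : ℕ → ℝ) (f : ℝ[X]), (∀ j, 0 ≤ b j) ∧ (∀ i, 0 ≤ f.coeff i) ∧
      (∀ j, k ≤ j → j < m → f.natDegree ≤ d j) ∧
      1 = ∑ j ∈ Finset.range k, C (b j) * (X ^ j * (1 - X) ^ d j) + X ^ k * f.comp (1 - X) := by
  induction k with
  | zero =>
    refine ⟨0, 1, by simp, fun i => ?_, by simp, by simp⟩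
    rw [coeff_one]
    split_ifs <;> norm_num
  | succ k ih =>
    obtain ⟨b, f, hb, hf, hfd, heq⟩ := ih (by omega)
    obtain ⟨g, hg, hgd, hfg⟩ := exists_sub_eval_one_mul_X_pow f (d k) hf (hfd k le_rfl hk)
    refine ⟨Function.update b k (f.eval 1), g, fun j => ?_, hg,
      fun j hj hjm => hgd.trans (hd k j (by omega) hjm), ?_⟩
    · rcases eq_or_ne j k with rfl | hjk
      · rw [Function.update_self, eval_eq_sum]
        exact Finset.sum_nonneg fun i _ => by simpa using hf i
      · rw [Function.update_of_ne hjk]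
        exact hb j
    · have hsum : ∑ j ∈ Finset.range k,
          C (Function.update b k (f.eval 1) j) * (X ^ j * (1 - X) ^ d j) =
          ∑ j ∈ Finset.range k, C (b j) * (X ^ j * (1 - X) ^ d j) := by
        refine Finset.sum_congr rfl fun j hj => ?_
        rw [Function.update_of_ne (Finset.mem_range.mp hj).ne]
      have hcomp : f.comp (1 - X) = C (f.eval 1) * (1 - X) ^ d k + X * g.comp (1 - X) := by
        conv_lhs => rw [hfg]
        simp
      rw [Finset.sum_range_succ, hsum, Function.update_self]
      rw [hcomp] at heq
      linear_combination heq

theorem eval_one_le_of_derivative_le_one (p : ℝ[X]) (h0 : p.eval 0 = 0)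
    (hp : ∀ x ∈ Set.Icc (0 : ℝ) 1, (derivative p).eval x ≤ 1) : p.eval 1 ≤ 1 := by
  have hmono : MonotoneOn (fun x => (X - p).eval x) (Set.Icc (0 : ℝ) 1) := by
    refine monotoneOn_of_deriv_nonneg (convex_Icc 0 1) (X - p).continuous.continuousOn
      (X - p).differentiable.differentiableOn fun x hx => ?_
    rw [Polynomial.deriv]
    simpa using hp x (interior_subset hx)
  have := hmono (by simp : (0 : ℝ) ∈ Set.Icc (0 : ℝ) 1) (by simp : (1 : ℝ) ∈ Set.Icc (0 : ℝ) 1)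
    zero_le_one
  simpa [h0] using this

theorem eval_zero_bgePolynomial_succ (n k : ℕ) : (bgePolynomial n (k + 1)).eval 0 = 0 := by
  rw [bgePolynomial, eval_finsetSum]
  refine Finset.sum_eq_zero fun j hj => ?_
  rw [bernsteinPolynomial.eval_at_0, if_neg (by have := (Finset.mem_Icc.mp hj).1; omega)]

theorem eval_one_bgePolynomial {n k : ℕ} (hkn : k ≤ n) : (bgePolynomial n k).eval 1 = 1 := by
  simp [bgePolynomial, eval_finsetSum, bernsteinPolynomial.eval_at_1, hkn]

/-- The polynomial representing `Psi` for the masses `a j` at `L j` with thresholds `j + 1`. -/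
noncomputable def massPolynomial (m : ℕ) (L : ℕ → ℕ) (a : ℕ → ℝ) : ℝ[X] :=
  ∑ j ∈ Finset.range m, C (a j) * bgePolynomial (L j) (j + 1)

theorem factorial_mul_coeff_derivative_massPolynomial (m : ℕ) (L : ℕ → ℕ) (a : ℕ → ℝ) (k : ℕ) :
    (k.factorial : ℝ) * (derivative (massPolynomial m L a)).coeff k =
      ∑ j ∈ Finset.range m,
        (-1) ^ (k + j) * (k.choose j : ℝ) * a j * ((L j).descFactorial (k + 1) : ℝ) := by
  rw [massPolynomial, derivative_sum, finsetSum_coeff, Finset.mul_sum]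
  refine Finset.sum_congr rfl fun j _ => ?_
  rw [derivative_C_mul, coeff_C_mul]
  linear_combination a j * factorial_mul_coeff_derivative_bgePolynomial (L j) j k

theorem concordant_massPolynomial_recursion {m : ℕ} {L : ℕ → ℕ} {a : ℕ → ℝ}
    (ha : Concordant m fun x => (massPolynomial m L a).eval x) {k : ℕ} (hk : k < m) :
    a k * ((L k).descFactorial (k + 1) : ℝ) = (if k = 0 then 1 else 0) -
      ∑ j ∈ Finset.range k,
        (-1) ^ (k + j) * (k.choose j : ℝ) * a j * ((L j).descFactorial (k + 1) : ℝ) := by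
  have H := (concordant_eval_iff m _).mp ha k hk
  rw [factorial_mul_coeff_derivative_massPolynomial] at H
  have hsub : ∑ j ∈ Finset.range (k + 1),
        (-1) ^ (k + j) * (k.choose j : ℝ) * a j * ((L j).descFactorial (k + 1) : ℝ) =
      ∑ j ∈ Finset.range m,
        (-1) ^ (k + j) * (k.choose j : ℝ) * a j * ((L j).descFactorial (k + 1) : ℝ) := by
    refine Finset.sum_subset (Finset.range_mono hk) fun j _ hj => ?_
    rw [Nat.choose_eq_zero_of_lt (by simpa [Nat.lt_succ_iff] using hj)]
    simp
  rw [← H, ← hsub, Finset.sum_range_succ, ← two_mul, pow_mul]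
  simp

theorem concordant_massPolynomial_unique {m : ℕ} {L : ℕ → ℕ} {a a' : ℕ → ℝ}
    (hL : ∀ j < m, j + 1 ≤ L j)
    (ha : Concordant m fun x => (massPolynomial m L a).eval x)
    (ha' : Concordant m fun x => (massPolynomial m L a').eval x) :
    ∀ k < m, a k = a' k := by
  intro k
  induction k using Nat.strong_induction_on with
  | _ k ih =>
    intro hk
    have hpos : ((L k).descFactorial (k + 1) : ℝ) ≠ 0 := by
      exact_mod_cast (Nat.descFactorial_pos.mpr (hL k hk)).ne'
    refine mul_right_cancel₀ hpos ?_
    rw [concordant_massPolynomial_recursion ha hk, concordant_massPolynomial_recursion ha' hk]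
    congr 1
    refine Finset.sum_congr rfl fun j hj => ?_
    have hjk := Finset.mem_range.mp hj
    rw [ih j hjk (hjk.trans hk)]

theorem exists_concordant_massPolynomial {m : ℕ} {L : ℕ → ℕ} (hL : ∀ j < m, j + 1 ≤ L j)
    (hmono : ∀ i j, i ≤ j → j < m → L i + j ≤ L j + i) :
    ∃ a : ℕ → ℝ, (∀ j, 0 ≤ a j) ∧ ∑ j ∈ Finset.range m, a j ≤ 1 ∧
      Concordant m fun x => (massPolynomial m L a).eval x := by
  obtain ⟨b, f, hb, hf, -, heq⟩ := exists_nonneg_expansion (fun j => L j - 1 - j) m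
    (fun i j hij hj => by have := hmono i j hij hj; omega) m le_rfl
  set a : ℕ → ℝ := fun j => b j / (L j * (L j - 1).choose j) with ha_def
  have hder : derivative (massPolynomial m L a) = 1 - X ^ m * f.comp (1 - X) := by
    rw [eq_sub_iff_add_eq]
    conv_rhs => rw [heq]
    rw [massPolynomial, derivative_sum]
    congr 1
    refine Finset.sum_congr rfl fun j hj => ?_
    have hLj := hL j (Finset.mem_range.mp hj)
    have h1 : (L j : ℝ) ≠ 0 := by
      have : L j ≠ 0 := by omega
      exact_mod_cast this
    have h2 : ((L j - 1).choose j : ℝ) ≠ 0 := by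
      exact_mod_cast (Nat.choose_pos (show j ≤ L j - 1 by omega)).ne'
    have hbj : b j = a j * L j * (L j - 1).choose j := by
      rw [ha_def]
      field_simp
    rw [derivative_C_mul, derivative_bgePolynomial_succ, bernsteinPolynomial, hbj]
    simp only [map_mul, C_eq_natCast]
    ring
  refine ⟨a, fun j => div_nonneg (hb j) (by positivity), ?_, ?_⟩
  · have hev : (massPolynomial m L a).eval 1 = ∑ j ∈ Finset.range m, a j := by
      rw [massPolynomial, eval_finsetSum]
      refine Finset.sum_congr rfl fun j hj => ?_
      rw [eval_mul, eval_C, eval_one_bgePolynomial (hL j (Finset.mem_range.mp hj)), mul_one]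
    rw [← hev]
    refine eval_one_le_of_derivative_le_one _ ?_ fun x hx => ?_
    · simp [massPolynomial, eval_finsetSum, eval_zero_bgePolynomial_succ]
    · have hfx : 0 ≤ f.eval (1 - x) := by
        rw [eval_eq_sum]
        exact Finset.sum_nonneg fun i _ =>
          mul_nonneg (hf i) (pow_nonneg (sub_nonneg.mpr hx.2) i)
      have := mul_nonneg (pow_nonneg hx.1 m) hfx
      simpa [hder] using this
  · rw [concordant_eval_iff]
    intro k hk
    rw [hder, coeff_sub, coeff_X_pow_mul', if_neg (by omega), coeff_one]
    split_ifs with h0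
    · simp [h0]
    · simp

theorem hasSum_of_supported {m : ℕ} {L : ℕ → ℕ} (hL : ∀ j < m, j + 1 ≤ L j)
    (hinj : Set.InjOn L (Finset.range m)) {g : ℕ → ℝ}
    (hg : ∀ n, g n ≠ 0 → n = 0 ∨ ∃ j < m, L j = n) :
    HasSum g (g 0 + ∑ j ∈ Finset.range m, g (L j)) := by
  have h0 : 0 ∉ (Finset.range m).image L := by
    simp only [Finset.mem_image, Finset.mem_range, not_exists, not_and]
    intro j hj
    have := hL j hj
    omega
  rw [← Finset.sum_image (f := g) hinj, ← Finset.sum_insert h0]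
  refine hasSum_sum_of_ne_finset_zero fun n hn => ?_
  by_contra hne
  refine hn ?_
  simpa using hg n hne

theorem Psi_eq_eval_massPolynomial {m : ℕ} {L h : ℕ → ℕ} (hL : ∀ j < m, j + 1 ≤ L j)
    (hinj : Set.InjOn L (Finset.range m)) (h0 : 1 ≤ h 0) (hh : ∀ j < m, h (L j) = j + 1)
    {χ : ℕ → ℝ} (hχ : ∀ n, χ n ≠ 0 → n = 0 ∨ ∃ j < m, L j = n) :
    Psi χ h = fun x => (massPolynomial m L fun j => χ (L j)).eval x := by
  ext x
  rw [Psi, (hasSum_of_supported hL hinj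
    fun n hn => hχ n (left_ne_zero_of_mul hn)).tsum_eq, massPolynomial, eval_finsetSum]
  have hB : Bge 0 (h 0) x = 0 := by
    rw [Bge, Finset.Icc_eq_empty (by omega), Finset.sum_empty]
  rw [hB, mul_zero, zero_add]
  refine Finset.sum_congr rfl fun j hj => ?_
  rw [hh j (Finset.mem_range.mp hj), eval_mul, eval_C, eval_bgePolynomial]

theorem stmt10 (m : ℕ) (hm : 1 ≤ m) (ℓ : ℕ → ℕ) (h : ℕ → ℕ)
    (hℓ1 : 1 ≤ ℓ 1)
    (hinc : ∀ k, 1 ≤ k → k < m → ℓ k < ℓ (k + 1))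
    (hh : ∀ n, 1 ≤ h n)
    (hhℓ : ∀ k, 1 ≤ k → k ≤ m → h (ℓ k) = k) :
    (∃! χ : ℕ → ℝ, IsChildDist χ ∧
        (∀ n, χ n ≠ 0 → n = 0 ∨ ∃ k, 1 ≤ k ∧ k ≤ m ∧ ℓ k = n) ∧
        Concordant m (Psi χ h)) ∧
    ∀ χ : ℕ → ℝ,
      (IsChildDist χ ∧
        (∀ n, χ n ≠ 0 → n = 0 ∨ ∃ k, 1 ≤ k ∧ k ≤ m ∧ ℓ k = n) ∧
        Concordant m (Psi χ h)) →
      χ (ℓ 1) = 1 / (ℓ 1 : ℝ) ∧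
      ∀ k, 2 ≤ k → k ≤ m →
        χ (ℓ k) = (1 / ((ℓ k).descFactorial k : ℝ)) *
          ∑ j ∈ Finset.Icc 1 (k - 1),
            (-1 : ℝ) ^ (k + j + 1) * ((k - 1).choose (j - 1) : ℝ) *
              χ (ℓ j) * ((ℓ j).descFactorial k : ℝ) := by
  have hgap : ∀ i j, i ≤ j → j < m → ℓ (i + 1) + j ≤ ℓ (j + 1) + i := by
    intro i j hij
    induction j, hij using Nat.le_induction with
    | base => intro _; rfl
    | succ j hij ih =>
      intro hj
      have := ih (by omega)
      have := hinc (j + 1) (by omega) hj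
      omega
  set L : ℕ → ℕ := fun j => ℓ (j + 1) with hL_def
  have hL : ∀ j < m, j + 1 ≤ L j := fun j hj => by
    have := hgap 0 j (Nat.zero_le j) hj
    simp only [zero_add] at this
    simp only [hL_def]
    omega
  have hinj : Set.InjOn L (Finset.range m) := by
    intro i hi j hj hij
    simp only [Finset.coe_range, Set.mem_Iio, hL_def] at hi hj hij
    rcases le_total i j with hle | hle
    · have := hgap i j hle hj
      omega
    · have := hgap j i hle hi
      omega
  have hhL : ∀ j < m, h (L j) = j + 1 := fun j hj => hhℓ (j + 1) (by omega) hj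
  have hsupp : ∀ χ : ℕ → ℝ, (∀ n, χ n ≠ 0 → n = 0 ∨ ∃ k, 1 ≤ k ∧ k ≤ m ∧ ℓ k = n) →
      ∀ n, χ n ≠ 0 → n = 0 ∨ ∃ j < m, L j = n := by
    intro χ hχ n hn
    refine (hχ n hn).imp_right ?_
    rintro ⟨k, hk, hkm, rfl⟩
    obtain ⟨k, rfl⟩ := Nat.exists_eq_add_of_le' hk
    exact ⟨k, hkm, rfl⟩
  have hPsi := fun χ hχ => Psi_eq_eval_massPolynomial hL hinj (hh 0) hhL (hsupp χ hχ)
  refine ⟨existsUnique_of_exists_of_unique ?_ ?_, ?_⟩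
  · obtain ⟨a, ha, hsum, hconc⟩ := exists_concordant_massPolynomial hL hgap
    set χ : ℕ → ℝ := fun n => if n = 0 then 1 - ∑ j ∈ Finset.range m, a j else
      ∑ j ∈ Finset.range m, if L j = n then a j else 0 with hχ_def
    have hχL : ∀ j < m, χ (L j) = a j := by
      intro j hj
      have hj0 := hL j hj
      simp only [hχ_def]
      rw [if_neg (by omega), Finset.sum_eq_single_of_mem j (Finset.mem_range.mpr hj), if_pos rfl]
      intro i hi hij
      exact if_neg fun hEq => hij (hinj (by simpa using hi) (by simpa using hj) hEq)
    have hχs : ∀ n, χ n ≠ 0 → n = 0 ∨ ∃ k, 1 ≤ k ∧ k ≤ m ∧ ℓ k = n := by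
      intro n hn
      by_contra! hcon
      refine hn ?_
      simp only [hχ_def]
      rw [if_neg hcon.1]
      refine Finset.sum_eq_zero fun j hj => if_neg ?_
      exact hcon.2 (j + 1) (by omega) (Finset.mem_range.mp hj)
    have hsumL : ∑ j ∈ Finset.range m, χ (L j) = ∑ j ∈ Finset.range m, a j :=
      Finset.sum_congr rfl fun j hj => hχL j (Finset.mem_range.mp hj)
    have hasSum := hasSum_of_supported hL hinj (hsupp χ hχs)
    have htotal : χ 0 + ∑ j ∈ Finset.range m, χ (L j) = 1 := by
      rw [hsumL]
      simp [hχ_def]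
    refine ⟨χ, ⟨fun n => ?_, hasSum.summable, hasSum.tsum_eq.trans htotal⟩, hχs, ?_⟩
    · simp only [hχ_def]
      split_ifs
      · linarith
      · refine Finset.sum_nonneg fun j _ => ?_
        split_ifs
        · exact ha j
        · exact le_rfl
    · rw [hPsi χ hχs]
      have hpoly : massPolynomial m L (fun j => χ (L j)) = massPolynomial m L a :=
        Finset.sum_congr rfl fun j hj => by
          rw [← hχL j (Finset.mem_range.mp hj)]
      rwa [hpoly]
  · rintro χ χ' ⟨⟨-, -, hone⟩, hχ, hc⟩ ⟨⟨-, -, hone'⟩, hχ', hc'⟩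
    rw [hPsi χ hχ] at hc
    rw [hPsi χ' hχ'] at hc'
    have hEq := concordant_massPolynomial_unique hL hc hc'
    rw [(hasSum_of_supported hL hinj (hsupp χ hχ)).tsum_eq] at hone
    rw [(hasSum_of_supported hL hinj (hsupp χ' hχ')).tsum_eq] at hone'
    have hsumEq : ∑ j ∈ Finset.range m, χ (L j) = ∑ j ∈ Finset.range m, χ' (L j) :=
      Finset.sum_congr rfl fun j hj => hEq j (Finset.mem_range.mp hj)
    ext n
    by_cases hn : n = 0 ∨ ∃ j < m, L j = n
    · rcases hn with rfl | ⟨j, hj, rfl⟩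
      · linarith
      · exact hEq j hj
    · rw [not_imp_comm.mp (hsupp χ hχ n) hn, not_imp_comm.mp (hsupp χ' hχ' n) hn]
  · rintro χ ⟨-, hχ, hc⟩
    rw [hPsi χ hχ] at hc
    have hrec := fun k (hk : k < m) => concordant_massPolynomial_recursion hc hk
    constructor
    · have h1 := hrec 0 hm
      have hne : (ℓ 1 : ℝ) ≠ 0 := by
        exact_mod_cast (show ℓ 1 ≠ 0 by omega)
      rw [eq_div_iff hne]
      simpa [hL_def] using h1
    · intro k hk hkm
      obtain ⟨k, rfl⟩ := Nat.exists_eq_add_of_le' (show 1 ≤ k by omega)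
      have hne : ((ℓ (k + 1)).descFactorial (k + 1) : ℝ) ≠ 0 := by
        exact_mod_cast (Nat.descFactorial_pos.mpr (hL k hkm)).ne'
      have hk' := hrec k hkm
      rw [if_neg (by omega), zero_sub, ← Finset.sum_neg_distrib] at hk'
      have hIcc : Finset.Icc 1 (k + 1 - 1) = Finset.Ico (0 + 1) (k + 1) := by
        ext
        simp
      rw [one_div, eq_inv_mul_iff_mul_eq₀ hne, mul_comm, hIcc, ← Finset.sum_Ico_add',
        ← Finset.range_eq_Ico]
      refine hk'.trans (Finset.sum_congr rfl fun j _ => ?_)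
      simp only [hL_def, add_tsub_cancel_right]
      ring
end

section
/- Let h be a threshold function that is (nonstrictly) increasing and satisfies h(ℓ) ≤ ℓ for all ℓ ≥ 1, and let χ be a child distribution with finite support, not equal to the point mass δ_1 at 1, such that (χ,h) is m-critical (m-concordant with maximum threshold m). Let Ψ be the automaton distribution map of (χ,h). Then Ψ(x) < x for all x ∈ (0,1], χ(0) > 0, and there exist nonnegative reals c_{ℓ,r}, indexed by ℓ ∈ tier_{χ,h}(m) and m+1 ≤ r ≤ ℓ, with Σ c_{ℓ,r} = 1, such that x − Ψ(x) = χ(0)·Σ c_{ℓ,r}·B≥_{ℓ,r}(x) for all x ∈ [0,1]; that is, (x − Ψ(x))/χ(0) is a convex combination of the polynomials B≥_{ℓ,r} with ℓ ∈ tier_{χ,h}(m) and r ≥ m+1. -/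
open Polynomial

/-- The polynomial whose evaluation is `Bge n k`. -/
noncomputable def BgePoly (n k : ℕ) : ℝ[X] :=
  ∑ j ∈ Finset.Icc k n, bernsteinPolynomial ℝ n j

lemma eval_BgePoly (n k : ℕ) (x : ℝ) : (BgePoly n k).eval x = Bge n k x := by
  simp [BgePoly, Bge, bernsteinPolynomial, eval_finsetSum]

lemma Bge_zero {n k : ℕ} (hk : 1 ≤ k) : Bge n k 0 = 0 := by
  refine Finset.sum_eq_zero fun j hj => ?_
  have : j ≠ 0 := by have := (Finset.mem_Icc.1 hj).1; omega
  simp [this]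

lemma Bge_one {n k : ℕ} (hk : k ≤ n) : Bge n k 1 = 1 := by
  rw [Bge, Finset.sum_eq_single_of_mem n (by simpa using hk)]
  · simp
  · intro j hj hjn
    have : n - j ≠ 0 := by have := (Finset.mem_Icc.1 hj).2; omega
    simp [this]

lemma pow_le_Bge {n k : ℕ} (hk : k ≤ n) {x : ℝ} (h0 : 0 ≤ x) (h1 : x ≤ 1) :
    x ^ n ≤ Bge n k x := by
  have h2 : 0 ≤ 1 - x := by linarith
  have := Finset.single_le_sum
    (f := fun j => (n.choose j : ℝ) * x ^ j * (1 - x) ^ (n - j)) (s := Finset.Icc k n)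
    (fun j _ => by positivity) (Finset.mem_Icc.2 ⟨hk, le_rfl⟩)
  simpa [Bge] using this

lemma derivative_BgePoly (n k : ℕ) :
    derivative (BgePoly n (k + 1)) =
      C ((n : ℝ) * ((n - 1).choose k : ℝ)) * X ^ k * (1 - X) ^ (n - (k + 1)) := by
  rcases n with _ | n
  · simp [BgePoly]
  have key : ∀ d : ℕ, d ≤ n + 1 → derivative (BgePoly (n + 1) (n + 1 - d + 1)) =
      ((n + 1 : ℕ) : ℝ[X]) * bernsteinPolynomial ℝ n (n + 1 - d) := by
    intro d
    induction d with
    | zero => simp [BgePoly, bernsteinPolynomial.eq_zero_of_lt]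
    | succ d ih =>
      intro hd
      have e : n + 1 - d = (n + 1 - (d + 1)) + 1 := by omega
      have hs : BgePoly (n + 1) (n + 1 - (d + 1) + 1) =
          bernsteinPolynomial ℝ (n + 1) (n + 1 - (d + 1) + 1) +
            BgePoly (n + 1) (n + 1 - d + 1) := by
        rw [BgePoly, BgePoly, e, ← Finset.add_sum_Ioc_eq_sum_Icc (by omega)]
        exact congrArg _ (Finset.sum_congr (by ext; simp) fun _ _ => rfl)
      rw [hs, derivative_add, ih (by omega), bernsteinPolynomial.derivative_succ, e]
      simp only [Nat.add_sub_cancel]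
      ring
  rcases le_or_gt k (n + 1) with hk | hk
  · have := key (n + 1 - k) (by omega)
    rw [show n + 1 - (n + 1 - k) = k by omega] at this
    rw [this, bernsteinPolynomial]
    simp only [Nat.add_sub_cancel, Nat.add_sub_add_right, map_mul, map_natCast]
    ring
  · rw [BgePoly, Finset.Icc_eq_empty (by omega), Nat.choose_eq_zero_of_lt (by omega)]
    simp

lemma iteratedDerivWithin_eval (p : ℝ[X]) (k : ℕ) :
    iteratedDerivWithin k (fun x => p.eval x) (Set.Icc (0 : ℝ) 1) 0 =
      (k.factorial : ℝ) * p.coeff k := by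
  have hp : ∀ (k : ℕ) (q : ℝ[X]), iteratedDeriv k (fun x => q.eval x) =
      fun x => (derivative^[k] q).eval x := by
    intro k
    induction k with
    | zero => intro q; simp
    | succ k ih =>
      intro q
      rw [iteratedDeriv_succ', Function.iterate_succ_apply, ← ih]
      congr 1
      ext x
      simp
  rw [iteratedDerivWithin_eq_iteratedDeriv (uniqueDiffOn_Icc zero_lt_one)
    (by simpa using (p.contDiff_aeval (𝕜 := ℝ) k).contDiffAt) (by simp), hp]
  simp only [← coeff_zero_eq_eval_zero, coeff_iterate_derivative]
  simp [Nat.descFactorial_self]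

lemma eq_of_derivative_eq_of_eval_zero_eq {p q : ℝ[X]} (hd : derivative p = derivative q)
    (h0 : p.eval 0 = q.eval 0) : p = q := by
  have h1 : derivative (p - q) = 0 := by simp [hd]
  have h2 := eq_C_of_natDegree_eq_zero (derivative_eq_zero.1 h1)
  rw [coeff_zero_eq_eval_zero, eval_sub, h0, sub_self, C_0] at h2
  exact sub_eq_zero.1 h2

/-- If `A = (1 - X) * B`, the coefficients of `B` are the partial sums of those of `A`. -/
lemma coeff_eq_sum_of_eq_one_sub_X_mul {A B : ℝ[X]} (hAB : A = (1 - X) * B) (j : ℕ) :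
    B.coeff j = ∑ i ∈ Finset.range (j + 1), A.coeff i := by
  subst hAB
  induction j with
  | zero => simp [sub_mul]
  | succ j ih => rw [Finset.sum_range_succ, ← ih]; simp [sub_mul, coeff_X_mul]

lemma one_sub_X_dvd_of_eval_one_eq_zero {A : ℝ[X]} (hA : A.eval 1 = 0) : 1 - X ∣ A := by
  have := dvd_iff_isRoot.2 (show A.IsRoot 1 from hA)
  rw [← neg_dvd]
  simpa using this

lemma sum_range_coeff_le_eval_one {A : ℝ[X]} (hA : ∀ i, 0 ≤ A.coeff i) (j : ℕ) :
    ∑ i ∈ Finset.range j, A.coeff i ≤ A.eval 1 := by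
  rw [eval_eq_sum_range' (n := max j (A.natDegree + 1)) (by omega)]
  simp only [one_pow, mul_one]
  exact Finset.sum_le_sum_of_subset_of_nonneg (by simp) fun i _ _ => hA i

lemma sum_range_coeff_eq_eval_one {A : ℝ[X]} {j : ℕ} (hA : ∀ i, j ≤ i → A.coeff i = 0) :
    ∑ i ∈ Finset.range j, A.coeff i = A.eval 1 := by
  rw [eval_eq_sum_range' (n := max j (A.natDegree + 1)) (by omega)]
  simp only [one_pow, mul_one]
  refine Finset.sum_subset (by simp) fun i _ hi => hA i (by simpa using hi)

/-- Dividing `G - P` by `1 - X` when the exponents of `G` precede those of `P`. -/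
lemma exists_eq_one_sub_X_mul {G P : ℝ[X]} (hG : ∀ i, 0 ≤ G.coeff i) (hP : ∀ i, 0 ≤ P.coeff i)
    (hGP : ∀ i j, G.coeff i ≠ 0 → P.coeff j ≠ 0 → i ≤ j) (h1 : G.eval 1 = P.eval 1) :
    ∃ B : ℝ[X], G - P = (1 - X) * B ∧ (∀ j, 0 ≤ B.coeff j) ∧
      ∀ j, B.coeff j ≠ 0 → ∃ i, j < i ∧ P.coeff i ≠ 0 := by
  obtain ⟨B, hB⟩ := one_sub_X_dvd_of_eval_one_eq_zero (A := G - P) (by simp [h1])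
  have hc (j : ℕ) := coeff_eq_sum_of_eq_one_sub_X_mul hB j
  simp only [coeff_sub, Finset.sum_sub_distrib] at hc
  have hnn : ∀ j, 0 ≤ B.coeff j := by
    intro j
    rw [hc j, sub_nonneg]
    by_cases hz : ∀ i ∈ Finset.range (j + 1), P.coeff i = 0
    · rw [Finset.sum_eq_zero hz]
      exact Finset.sum_nonneg fun i _ => hG i
    · push Not at hz
      obtain ⟨i, hi, hPi⟩ := hz
      have hi : i < j + 1 := by simpa using hi
      rw [sum_range_coeff_eq_eval_one (A := G), h1]
      · exact sum_range_coeff_le_eval_one hP _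
      · intro t ht
        by_contra hne
        have := hGP t i hne hPi
        omega
  refine ⟨B, hB, hnn, fun j hj => ?_⟩
  by_contra! hcon
  have h2 := sum_range_coeff_eq_eval_one (A := P) (j := j + 1) fun i hi => hcon i (by omega)
  have h3 := sum_range_coeff_le_eval_one hG (j + 1)
  have h4 := hc j
  have h5 := (hnn j).lt_of_ne' hj
  linarith

/-- The automaton distribution map of a finitely supported system as a polynomial. -/
noncomputable def PsiPoly (χ : ℕ → ℝ) (h : ℕ → ℕ) (N : ℕ) : ℝ[X] :=
  ∑ n ∈ Finset.Icc 1 N, C (χ n) * BgePoly n (h n)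

/-- The coefficient contributed to the derivative of `Ψ` by `n`, if `h n = k + 1`. -/
noncomputable def tierWeight (χ : ℕ → ℝ) (h : ℕ → ℕ) (k n : ℕ) : ℝ :=
  if h n = k + 1 then χ n * (n * ((n - 1).choose k : ℝ)) else 0

/-- The contribution of the threshold `k + 1` to the derivative of `Ψ`, as a polynomial in
`1 - x` and up to the factor `x ^ k`. -/
noncomputable def tierPoly (χ : ℕ → ℝ) (h : ℕ → ℕ) (N k : ℕ) : ℝ[X] :=
  ∑ n ∈ Finset.Icc 1 N, C (tierWeight χ h k n) * X ^ (n - (k + 1))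

section
variable {χ : ℕ → ℝ} {h : ℕ → ℕ} {N : ℕ}

lemma tsum_eq_zero_add_sum_Icc {f : ℕ → ℝ} (hf : ∀ n, N < n → f n = 0) :
    ∑' n, f n = f 0 + ∑ n ∈ Finset.Icc 1 N, f n := by
  rw [tsum_eq_sum (s := insert 0 (Finset.Icc 1 N)), Finset.sum_insert (by simp)]
  intro n hn
  simp only [Finset.mem_insert, Finset.mem_Icc] at hn
  exact hf n (by omega)

lemma Psi_eq_eval (hh : ∀ n, 1 ≤ h n) (hfin : ∀ n, N < n → χ n = 0) (x : ℝ) :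
    Psi χ h x = (PsiPoly χ h N).eval x := by
  have h0 : Bge 0 (h 0) x = 0 := by
    rw [Bge, Finset.Icc_eq_empty (by have := hh 0; omega), Finset.sum_empty]
  rw [Psi, tsum_eq_zero_add_sum_Icc (N := N) (fun n hn => by simp [hfin n hn]), h0]
  simp [PsiPoly, eval_finsetSum, eval_BgePoly]

lemma derivative_PsiPoly {m : ℕ} (hh : ∀ n, 1 ≤ h n) (hχ : ∀ n, 0 ≤ χ n)
    (hmaxle : ∀ n, 0 < χ n → h n ≤ m) :
    derivative (PsiPoly χ h N) =
      ∑ k ∈ Finset.range m, X ^ k * (tierPoly χ h N k).comp (1 - X) := by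
  simp only [PsiPoly, tierPoly, Polynomial.sum_comp, Finset.mul_sum, derivative_sum]
  rw [Finset.sum_comm]
  refine Finset.sum_congr rfl fun n _ => ?_
  rcases (hχ n).eq_or_lt with h0 | hpos
  · simp [← h0, tierWeight]
  obtain ⟨k, hk⟩ : ∃ k, h n = k + 1 := ⟨h n - 1, by have := hh n; omega⟩
  have hkm := hmaxle n hpos
  rw [Finset.sum_eq_single_of_mem k (by simp; omega)]
  · rw [derivative_C_mul, hk, derivative_BgePoly, tierWeight, if_pos hk]
    simp only [mul_comp, C_comp, pow_comp, X_comp, map_mul]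
    ring
  · intro j _ hj
    rw [tierWeight, if_neg (by omega)]
    simp

lemma tierWeight_nonneg (hχ : ∀ n, 0 ≤ χ n) (k n : ℕ) : 0 ≤ tierWeight χ h k n := by
  have := hχ n
  unfold tierWeight
  split_ifs <;> positivity

lemma of_tierWeight_ne_zero (hχ : ∀ n, 0 ≤ χ n) {k n : ℕ} (hne : tierWeight χ h k n ≠ 0) :
    h n = k + 1 ∧ 0 < χ n ∧ k + 1 ≤ n := by
  unfold tierWeight at hne
  split_ifs at hne with hk
  · simp only [ne_eq, mul_eq_zero, Nat.cast_eq_zero, not_or, Nat.choose_eq_zero_iff] at hne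
    exact ⟨hk, (hχ n).lt_of_ne' hne.1, by omega⟩
  · exact absurd rfl hne

lemma coeff_tierPoly (k j : ℕ) : (tierPoly χ h N k).coeff j =
    ∑ n ∈ Finset.Icc 1 N, if j = n - (k + 1) then tierWeight χ h k n else 0 := by
  simp [tierPoly, coeff_X_pow]

lemma coeff_tierPoly_nonneg (hχ : ∀ n, 0 ≤ χ n) (k j : ℕ) :
    0 ≤ (tierPoly χ h N k).coeff j := by
  rw [coeff_tierPoly]
  refine Finset.sum_nonneg fun n _ => ?_
  have := tierWeight_nonneg (h := h) hχ k n
  split_ifs <;> simp [this]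

lemma of_coeff_tierPoly_ne_zero (hχ : ∀ n, 0 ≤ χ n) {k j : ℕ}
    (hne : (tierPoly χ h N k).coeff j ≠ 0) :
    h (j + k + 1) = k + 1 ∧ 0 < χ (j + k + 1) := by
  rw [coeff_tierPoly] at hne
  obtain ⟨n, _, hn⟩ := Finset.exists_ne_zero_of_sum_ne_zero hne
  split_ifs at hn with hj
  · obtain ⟨h1, h2, h3⟩ := of_tierWeight_ne_zero hχ hn
    obtain rfl : n = j + k + 1 := by omega
    exact ⟨h1, h2⟩
  · exact absurd rfl hn

lemma one_sub_X_pow_dvd_of_concordant {m : ℕ} (hh : ∀ n, 1 ≤ h n) (hχ : ∀ n, 0 ≤ χ n)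
    (hfin : ∀ n, N < n → χ n = 0) (hmaxle : ∀ n, 0 < χ n → h n ≤ m)
    (hconc : Concordant m (Psi χ h)) :
    (1 - X) ^ m ∣ 1 - ∑ k ∈ Finset.range m, (1 - X) ^ k * tierPoly χ h N k := by
  have hPsi : Psi χ h = fun x => (PsiPoly χ h N).eval x := funext (Psi_eq_eval hh hfin)
  have hcoeff : ∀ d < m, (1 - derivative (PsiPoly χ h N)).coeff d = 0 := by
    intro d hd
    rw [hPsi] at hconc
    rw [coeff_sub, coeff_derivative]
    rcases d with _ | d
    · have := hconc.1 (by omega)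
      rw [iteratedDerivWithin_eval] at this
      simp at this
      simp [this]
    · have := hconc.2 (d + 1 + 1) (by omega) hd
      rw [iteratedDerivWithin_eval] at this
      have := (mul_eq_zero.1 this).resolve_left (by positivity)
      simp [this, coeff_one]
  obtain ⟨Q, hQ⟩ := X_pow_dvd_iff.2 hcoeff
  refine ⟨Q.comp (1 - X), ?_⟩
  have := congrArg (fun p : ℝ[X] => p.comp (1 - X)) hQ
  simp only [derivative_PsiPoly hh hχ hmaxle, sub_comp, one_comp, Polynomial.sum_comp, mul_comp,
    pow_comp, X_comp, comp_assoc, sub_sub_cancel, comp_X] at this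
  exact this

lemma one_sub_X_pow_dvd_truncate {P : ℕ → ℝ[X]} {m j : ℕ} (hj : j ≤ m)
    (hdvd : (1 - X) ^ m ∣ 1 - ∑ k ∈ Finset.range m, (1 - X) ^ k * P k) :
    (1 - X) ^ j ∣ 1 - ∑ k ∈ Finset.range j, (1 - X) ^ k * P k := by
  induction hj using Nat.decreasingInduction with
  | self => exact hdvd
  | of_succ k _ ih =>
    rw [Finset.sum_range_succ, ← sub_sub] at ih
    exact (dvd_sub_left (Dvd.intro _ rfl)).1 ((pow_dvd_pow _ k.le_succ).trans ih)

lemma eval_one_eq_of_truncate {P : ℕ → ℝ[X]} {m k : ℕ} (hk : k < m) {G : ℝ[X]}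
    (hdvd : (1 - X) ^ m ∣ 1 - ∑ k ∈ Finset.range m, (1 - X) ^ k * P k)
    (hG : 1 - ∑ i ∈ Finset.range k, (1 - X) ^ i * P i = (1 - X) ^ k * G) :
    G.eval 1 = (P k).eval 1 := by
  have hne : (1 - X : ℝ[X]) ≠ 0 := fun h0 => by simpa using congrArg (eval 0) h0
  have h1 := one_sub_X_pow_dvd_truncate (Nat.succ_le_of_lt hk) hdvd
  rw [Finset.sum_range_succ, ← sub_sub, hG, ← mul_sub, pow_succ,
    mul_dvd_mul_iff_left (pow_ne_zero _ hne)] at h1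
  obtain ⟨Q, hQ⟩ := h1
  have := congrArg (eval 1) hQ
  simp at this
  linarith

lemma exists_quotient {m : ℕ} (hmono : Monotone h) (hχ : ∀ n, 0 ≤ χ n)
    (hdvd : (1 - X) ^ m ∣ 1 - ∑ k ∈ Finset.range m, (1 - X) ^ k * tierPoly χ h N k)
    {k : ℕ} (hk : k < m) :
    ∃ G : ℝ[X], 1 - ∑ i ∈ Finset.range k, (1 - X) ^ i * tierPoly χ h N i = (1 - X) ^ k * G ∧
      (∀ j, 0 ≤ G.coeff j) ∧
      ∀ j, G.coeff j ≠ 0 → ∀ n, 1 ≤ n → k + 1 ≤ h n →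
        j + k + 1 ≤ n ∧ (1 ≤ k → j + k + 1 < n) := by
  induction k with
  | zero =>
    refine ⟨1, by simp, fun j => ?_, fun j hj n hn _ => ?_⟩
    · rw [coeff_one]; split_ifs <;> norm_num
    · rw [coeff_one] at hj
      have : j = 0 := by by_contra h0; simp [h0] at hj
      omega
  | succ k ih =>
    obtain ⟨G, hG, hGnn, hGs⟩ := ih (by omega)
    obtain ⟨B, hB, hBnn, hBs⟩ := exists_eq_one_sub_X_mul hGnn (coeff_tierPoly_nonneg hχ k)
      (fun i j hi hj => by
        have h1 := of_coeff_tierPoly_ne_zero hχ hj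
        have := (hGs i hi (j + k + 1) (by omega) h1.1.ge).1
        omega) (eval_one_eq_of_truncate (by omega) hdvd hG)
    refine ⟨B, ?_, hBnn, fun j hj n _ hn => ?_⟩
    · rw [Finset.sum_range_succ, ← sub_sub, hG, ← mul_sub, hB, pow_succ, mul_assoc]
    · obtain ⟨i, hji, hi⟩ := hBs j hj
      have h1 := of_coeff_tierPoly_ne_zero hχ hi
      have : i + k + 1 < n := by
        by_contra! hcon
        have := hmono hcon
        omega
      omega

lemma X_pow_mul_sub_eq_sum_derivative_BgePoly {n k i : ℕ} (hk : k + 1 ≤ n)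
    (hi : i ≤ n - (k + 1)) :
    (X : ℝ[X]) ^ k * ((1 - X) ^ i - (1 - X) ^ (n - (k + 1))) =
      ∑ r ∈ Finset.Icc (k + 1 + 1) n,
        C (((n - (k + 1) - i).choose (r - (k + 1)) : ℝ) / (n * ((n - 1).choose (r - 1) : ℝ))) *
          derivative (BgePoly n r) := by
  obtain ⟨d, rfl⟩ : ∃ d, n = k + 1 + d := ⟨n - (k + 1), by omega⟩
  rw [Nat.add_sub_cancel_left] at hi ⊢
  have hterm : ∀ a ∈ Finset.range d,
      C (((d - i).choose (k + 1 + 1 + a - (k + 1)) : ℝ) /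
        ((k + 1 + d : ℕ) * ((k + 1 + d - 1).choose (k + 1 + 1 + a - 1) : ℝ))) *
          derivative (BgePoly (k + 1 + d) (k + 1 + 1 + a)) =
      X ^ k * (X ^ (a + 1) * (1 - X) ^ (d - (a + 1)) * ((d - i).choose (a + 1) : ℝ[X])) := by
    intro a ha
    have ha : a < d := by simpa using ha
    rw [show k + 1 + 1 + a = (k + 1 + a) + 1 by ring, derivative_BgePoly]
    have hne : (((k + 1 + d : ℕ) : ℝ) * ((k + 1 + d - 1).choose (k + 1 + a) : ℝ)) ≠ 0 := by
      refine mul_ne_zero (by positivity) ?_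
      exact_mod_cast (Nat.choose_pos (by omega)).ne'
    rw [← mul_assoc, ← mul_assoc, ← C_mul, Nat.add_sub_cancel, div_mul_cancel₀ _ hne,
      show k + 1 + a + 1 - (k + 1) = a + 1 by omega,
      show k + 1 + d - (k + 1 + a + 1) = d - (a + 1) by omega, C_eq_natCast]
    ring
  have hIcc : Finset.Icc (k + 1 + 1) (k + 1 + d) = Finset.Ico (k + 1 + 1) (k + 1 + d + 1) := by
    ext; simp
  rw [hIcc, Finset.sum_Ico_eq_sum_range, show k + 1 + d + 1 - (k + 1 + 1) = d by omega,
    Finset.sum_congr rfl hterm, ← Finset.mul_sum]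
  congr 1
  have hbin : ((1 : ℝ[X]) - X) ^ i = ∑ a ∈ Finset.range (d + 1),
      X ^ a * (1 - X) ^ (d - a) * ((d - i).choose a : ℝ[X]) := by
    calc ((1 : ℝ[X]) - X) ^ i = (X + (1 - X)) ^ (d - i) * (1 - X) ^ i := by simp
      _ = ∑ a ∈ Finset.range (d - i + 1),
          X ^ a * (1 - X) ^ (d - a) * ((d - i).choose a : ℝ[X]) := by
        rw [add_pow, Finset.sum_mul]
        refine Finset.sum_congr rfl fun a ha => ?_
        have ha : a < d - i + 1 := by simpa using ha
        rw [show d - a = (d - i - a) + i by omega, pow_add]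
        ring
      _ = _ := by
        refine Finset.sum_subset (Finset.range_mono (by omega)) fun a _ ha => ?_
        rw [Nat.choose_eq_zero_of_lt (by simpa using ha)]
        simp
  rw [hbin, Finset.sum_range_succ']
  simp

lemma C_eval_one_mul_sub_comp {k : ℕ} {G : ℝ[X]}
    (h1 : G.eval 1 = (tierPoly χ h N k).eval 1) :
    C (G.eval 1) * (G - tierPoly χ h N k).comp (1 - X) =
      ∑ n ∈ Finset.Icc 1 N, ∑ i ∈ Finset.range (G.natDegree + 1),
        C (tierWeight χ h k n * G.coeff i) * ((1 - X) ^ i - (1 - X) ^ (n - (k + 1))) := by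
  have hG : G.comp (1 - X) =
      ∑ i ∈ Finset.range (G.natDegree + 1), C (G.coeff i) * (1 - X) ^ i := by
    conv_lhs => rw [as_sum_range_C_mul_X_pow G]
    simp [Polynomial.sum_comp]
  have hP : (tierPoly χ h N k).comp (1 - X) =
      ∑ n ∈ Finset.Icc 1 N, C (tierWeight χ h k n) * (1 - X) ^ (n - (k + 1)) := by
    simp [tierPoly, Polynomial.sum_comp]
  have hS : C (G.eval 1) = ∑ i ∈ Finset.range (G.natDegree + 1), C (G.coeff i) := by
    simp [eval_eq_sum_range]
  have hS' : C (G.eval 1) = ∑ n ∈ Finset.Icc 1 N, C (tierWeight χ h k n) := by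
    rw [h1]; simp [tierPoly, eval_finsetSum]
  rw [sub_comp, mul_sub]
  conv_lhs => rw [hG, hP]; arg 1; rw [hS']
  rw [hS, Finset.sum_mul_sum, Finset.sum_mul_sum, Finset.sum_comm (s := Finset.range _),
    ← Finset.sum_sub_distrib]
  refine Finset.sum_congr rfl fun n _ => ?_
  rw [← Finset.sum_sub_distrib]
  refine Finset.sum_congr rfl fun i _ => ?_
  rw [C_mul]
  ring

/-- The unnormalised weights of the polynomials `BgePoly n r` in `X - Ψ`. -/
noncomputable def decompWeight (χ : ℕ → ℝ) (h : ℕ → ℕ) (k : ℕ) (G : ℝ[X]) (n r : ℕ) : ℝ :=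
  if r ∈ Finset.Icc (k + 1 + 1) n then
    tierWeight χ h k n * ∑ i ∈ Finset.range (G.natDegree + 1), G.coeff i *
      (((n - (k + 1) - i).choose (r - (k + 1)) : ℝ) / (n * ((n - 1).choose (r - 1) : ℝ)))
  else 0

lemma C_eval_one_mul_X_sub_PsiPoly {k : ℕ} {G : ℝ[X]} (hh : ∀ n, 1 ≤ h n)
    (hχ : ∀ n, 0 ≤ χ n) (hmaxle : ∀ n, 0 < χ n → h n ≤ k + 1)
    (hG : 1 - ∑ i ∈ Finset.range k, (1 - X) ^ i * tierPoly χ h N i = (1 - X) ^ k * G)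
    (hGs : ∀ j, G.coeff j ≠ 0 → ∀ n, 1 ≤ n → k + 1 ≤ h n → j + k + 1 ≤ n)
    (h1 : G.eval 1 = (tierPoly χ h N k).eval 1) :
    C (G.eval 1) * (X - PsiPoly χ h N) =
      ∑ n ∈ Finset.Icc 1 N, ∑ r ∈ Finset.Icc (k + 1 + 1) n,
        C (decompWeight χ h k G n r) * BgePoly n r := by
  apply eq_of_derivative_eq_of_eval_zero_eq
  · have hD : 1 - derivative (PsiPoly χ h N) =
        X ^ k * (G - tierPoly χ h N k).comp (1 - X) := by
      have := congrArg (fun p : ℝ[X] => p.comp (1 - X)) hG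
      simp only [sub_comp, one_comp, Polynomial.sum_comp, mul_comp, pow_comp, X_comp,
        sub_sub_cancel] at this
      rw [derivative_PsiPoly hh hχ hmaxle, Finset.sum_range_succ, ← sub_sub, this, sub_comp,
        mul_sub]
    rw [derivative_C_mul, derivative_sub, derivative_X, hD, mul_left_comm,
      C_eval_one_mul_sub_comp h1, derivative_sum, Finset.mul_sum]
    refine Finset.sum_congr rfl fun n _ => ?_
    rw [derivative_sum, Finset.mul_sum]
    have hrhs : ∀ r ∈ Finset.Icc (k + 1 + 1) n,
        derivative (C (decompWeight χ h k G n r) * BgePoly n r) =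
        ∑ i ∈ Finset.range (G.natDegree + 1), C (tierWeight χ h k n * G.coeff i) *
          (C (((n - (k + 1) - i).choose (r - (k + 1)) : ℝ) /
            (n * ((n - 1).choose (r - 1) : ℝ))) * derivative (BgePoly n r)) := by
      intro r hr
      rw [derivative_C_mul, decompWeight, if_pos hr, Finset.mul_sum, map_sum, Finset.sum_mul]
      refine Finset.sum_congr rfl fun i _ => ?_
      rw [← mul_assoc, ← mul_assoc, C_mul, C_mul]
    rw [Finset.sum_congr rfl hrhs, Finset.sum_comm]
    refine Finset.sum_congr rfl fun i _ => ?_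
    rw [← Finset.mul_sum]
    by_cases hz : tierWeight χ h k n * G.coeff i = 0
    · simp [hz]
    · obtain ⟨hw, hg⟩ := mul_ne_zero_iff.1 hz
      obtain ⟨h2, -, h4⟩ := of_tierWeight_ne_zero hχ hw
      have := hGs i hg n (by omega) h2.ge
      rw [← X_pow_mul_sub_eq_sum_derivative_BgePoly h4 (by omega)]
      ring
  · have hB : ∀ n r, 1 ≤ r → (BgePoly n r).eval 0 = 0 := fun n r hr => by
      rw [eval_BgePoly, Bge_zero hr]
    have hR : ∀ n, ∑ r ∈ Finset.Icc (k + 1 + 1) n,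
        decompWeight χ h k G n r * (BgePoly n r).eval 0 = 0 := fun n =>
      Finset.sum_eq_zero fun r hr => by
        rw [hB n r (by have := (Finset.mem_Icc.1 hr).1; omega), mul_zero]
    simp [PsiPoly, eval_finsetSum, hB _ _ (hh _), hR]

lemma decompWeight_nonneg {k : ℕ} {G : ℝ[X]} (hχ : ∀ n, 0 ≤ χ n) (hG : ∀ j, 0 ≤ G.coeff j)
    (n r : ℕ) : 0 ≤ decompWeight χ h k G n r := by
  unfold decompWeight
  split_ifs
  · exact mul_nonneg (tierWeight_nonneg hχ k n)
      (Finset.sum_nonneg fun i _ => mul_nonneg (hG i) (by positivity))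
  · exact le_rfl

lemma of_decompWeight_ne_zero {k : ℕ} {G : ℝ[X]} (hχ : ∀ n, 0 ≤ χ n) {n r : ℕ}
    (hne : decompWeight χ h k G n r ≠ 0) :
    1 ≤ n ∧ h n = k + 1 ∧ 0 < χ n ∧ k + 1 + 1 ≤ r ∧ r ≤ n := by
  unfold decompWeight at hne
  split_ifs at hne with hr
  · obtain ⟨h1, h2, h3⟩ := of_tierWeight_ne_zero hχ (left_ne_zero_of_mul hne)
    obtain ⟨h4, h5⟩ := Finset.mem_Icc.1 hr
    exact ⟨by omega, h1, h2, h4, h5⟩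
  · exact absurd rfl hne

lemma one_sub_Psi_one (hχ : IsChildDist χ) (hh : ∀ n, 1 ≤ h n) (hle : ∀ n, 1 ≤ n → h n ≤ n)
    (hfin : ∀ n, N < n → χ n = 0) : 1 - Psi χ h 1 = χ 0 := by
  have h1 := hχ.2.2
  rw [tsum_eq_zero_add_sum_Icc hfin] at h1
  have h2 : Psi χ h 1 = ∑ n ∈ Finset.Icc 1 N, χ n := by
    rw [Psi_eq_eval hh hfin, PsiPoly, eval_finsetSum]
    refine Finset.sum_congr rfl fun n hn => ?_
    rw [eval_mul, eval_C, eval_BgePoly, Bge_one (hle n (Finset.mem_Icc.1 hn).1), mul_one]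
  linarith

/-- The remainder `G` has positive total mass, since the top tier is nonempty. -/
lemma eval_one_pos {k : ℕ} {G : ℝ[X]} (hχ : ∀ n, 0 ≤ χ n) (hfin : ∀ n, N < n → χ n = 0)
    (hmono : Monotone h) (hle : ∀ n, 1 ≤ n → h n ≤ n)
    (hmaxeq : ∃ n, 0 < χ n ∧ h n = k + 1)
    (hG : 1 - ∑ i ∈ Finset.range k, (1 - X) ^ i * tierPoly χ h N i = (1 - X) ^ k * G)
    (h1 : G.eval 1 = (tierPoly χ h N k).eval 1) : 0 < G.eval 1 := by
  obtain ⟨n, hn, hnk⟩ := hmaxeq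
  rcases Nat.eq_zero_or_pos n with rfl | hn1
  · have h2 := hmono (Nat.zero_le 1)
    have h3 := hle 1 le_rfl
    obtain rfl : k = 0 := by omega
    simp at hG
    simp [← hG]
  · rw [h1, tierPoly, eval_finsetSum]
    have hnN : n ≤ N := by
      by_contra! hcon
      exact hn.ne' (hfin n hcon)
    refine Finset.sum_pos' (fun j _ => by simpa using tierWeight_nonneg hχ k j)
      ⟨n, Finset.mem_Icc.2 ⟨hn1, hnN⟩, ?_⟩
    have hkn := hle n hn1
    have : 0 < (n - 1).choose k := Nat.choose_pos (by omega)
    simp only [eval_mul, eval_C, eval_pow, eval_X, one_pow, mul_one, tierWeight, if_pos hnk]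
    positivity

/-- The remainder `G` differs from the top tier polynomial unless `χ` is the point mass at `1`. -/
lemma ne_tierPoly {k : ℕ} {G : ℝ[X]} (hχ : IsChildDist χ) (hfin : ∀ n, N < n → χ n = 0)
    (hne : χ ≠ fun n => if n = 1 then 1 else 0)
    (hG : 1 - ∑ i ∈ Finset.range k, (1 - X) ^ i * tierPoly χ h N i = (1 - X) ^ k * G)
    (hGs : ∀ j, G.coeff j ≠ 0 → ∀ n, 1 ≤ n → k + 1 ≤ h n → 1 ≤ k → j + k + 1 < n)
    (hpos : 0 < G.eval 1) : G ≠ tierPoly χ h N k := by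
  intro hGP
  rcases Nat.eq_zero_or_pos k with rfl | hk
  · simp only [Finset.range_zero, Finset.sum_empty, sub_zero, pow_zero, one_mul] at hG
    have h0 : (tierPoly χ h N 0).coeff 0 = 1 := by rw [← hGP, ← hG]; simp
    have h1 : χ 1 = 1 := by
      obtain ⟨h2, -⟩ := of_coeff_tierPoly_ne_zero (h := h) hχ.1 (h0 ▸ one_ne_zero)
      have hN : 1 ∈ Finset.Icc 1 N := by
        rcases Nat.eq_zero_or_pos N with rfl | hN
        · simp [tierPoly] at h0
        · exact Finset.mem_Icc.2 ⟨le_rfl, hN⟩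
      rw [coeff_tierPoly, Finset.sum_eq_single_of_mem 1 hN] at h0
      · simpa [tierWeight, h2] using h0
      · intro n hn hn1
        have := (Finset.mem_Icc.1 hn).1
        rw [if_neg (by omega)]
    refine hne (funext fun n => ?_)
    split_ifs with hn
    · rw [hn, h1]
    · have h2 := hχ.2.1.sum_le_tsum {1, n} fun i _ => hχ.1 i
      rw [hχ.2.2, Finset.sum_pair (Ne.symm hn), h1] at h2
      linarith [hχ.1 n]
  · have hG0 : G ≠ 0 := by rintro rfl; simp at hpos
    obtain ⟨j, hj⟩ : ∃ j, G.coeff j ≠ 0 := by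
      by_contra! hcon
      exact hG0 (ext hcon)
    obtain ⟨h2, -⟩ := of_coeff_tierPoly_ne_zero hχ.1 (hGP ▸ hj)
    exact lt_irrefl _ (hGs j hj (j + k + 1) (by omega) h2.ge hk)

end

theorem stmt15 (m : ℕ) (hm : 1 ≤ m) (h : ℕ → ℕ) (hh : ∀ n, 1 ≤ h n)
    (hmono : Monotone h) (hle : ∀ n, 1 ≤ n → h n ≤ n)
    (χ : ℕ → ℝ) (hχ : IsChildDist χ)
    (N : ℕ) (hfin : ∀ n, N < n → χ n = 0)
    (hne : χ ≠ fun n => if n = 1 then 1 else 0)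
    (hconc : Concordant m (Psi χ h))
    (hmaxle : ∀ n, 0 < χ n → h n ≤ m)
    (hmaxeq : ∃ n, 0 < χ n ∧ h n = m) :
    (∀ x ∈ Set.Ioc (0 : ℝ) 1, Psi χ h x < x) ∧ 0 < χ 0 ∧
    ∃ c : ℕ → ℕ → ℝ,
      (∀ n r, 0 ≤ c n r) ∧
      (∀ n r, c n r ≠ 0 → 1 ≤ n ∧ h n = m ∧ 0 < χ n ∧ m + 1 ≤ r ∧ r ≤ n) ∧
      (∑ n ∈ Finset.Icc 1 N, ∑ r ∈ Finset.Icc (m + 1) n, c n r) = 1 ∧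
      ∀ x ∈ Set.Icc (0 : ℝ) 1,
        x - Psi χ h x =
          χ 0 * ∑ n ∈ Finset.Icc 1 N, ∑ r ∈ Finset.Icc (m + 1) n, c n r * Bge n r x := by
  obtain ⟨k, rfl⟩ : ∃ k, m = k + 1 := ⟨m - 1, by omega⟩
  have hdvd := one_sub_X_pow_dvd_of_concordant hh hχ.1 hfin hmaxle hconc
  obtain ⟨G, hG, hGnn, hGs⟩ := exists_quotient hmono hχ.1 hdvd (Nat.lt_succ_self k)
  have h1 := eval_one_eq_of_truncate (Nat.lt_succ_self k) hdvd hG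
  have hS := eval_one_pos hχ.1 hfin hmono hle hmaxeq hG h1
  have hid := C_eval_one_mul_X_sub_PsiPoly hh hχ.1 hmaxle hG
    (fun j hj n hn hkn => (hGs j hj n hn hkn).1) h1
  set S := G.eval 1
  set w := decompWeight χ h k G
  have hwnn : ∀ n r, 0 ≤ w n r := decompWeight_nonneg hχ.1 hGnn
  have hev : ∀ x, S * (x - Psi χ h x) =
      ∑ n ∈ Finset.Icc 1 N, ∑ r ∈ Finset.Icc (k + 1 + 1) n, w n r * Bge n r x := by
    intro x
    have := congrArg (eval x) hid
    simpa [eval_finsetSum, eval_BgePoly, ← Psi_eq_eval hh hfin] using this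
  have hsum : ∑ n ∈ Finset.Icc 1 N, ∑ r ∈ Finset.Icc (k + 1 + 1) n, w n r = S * χ 0 := by
    rw [← one_sub_Psi_one hχ hh hle hfin, hev 1]
    refine Finset.sum_congr rfl fun n _ => Finset.sum_congr rfl fun r hr => ?_
    rw [Bge_one (Finset.mem_Icc.1 hr).2, mul_one]
  have hχ0 : 0 < χ 0 := by
    refine (hχ.1 0).lt_of_ne fun h0 => ?_
    rw [← h0, mul_zero, Finset.sum_eq_zero_iff_of_nonneg
      fun n _ => Finset.sum_nonneg fun r _ => hwnn n r] at hsum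
    have hw0 : ∀ n ∈ Finset.Icc 1 N, ∀ r ∈ Finset.Icc (k + 1 + 1) n, w n r = 0 :=
      fun n hn => (Finset.sum_eq_zero_iff_of_nonneg fun r _ => hwnn n r).1 (hsum n hn)
    rw [Finset.sum_eq_zero fun n hn => Finset.sum_eq_zero fun r hr => by
      rw [hw0 n hn r hr, C_0, zero_mul]] at hid
    have hX : X - PsiPoly χ h N = 0 :=
      (mul_eq_zero.1 hid).resolve_left (by simpa using hS.ne')
    have hD := congrArg (fun p : ℝ[X] => (derivative p).comp (1 - X)) hX
    simp only [derivative_sub, derivative_X, derivative_PsiPoly hh hχ.1 hmaxle, sub_comp,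
      one_comp, Polynomial.sum_comp, mul_comp, pow_comp, X_comp, comp_assoc, sub_sub_cancel, comp_X,
      derivative_zero, zero_comp] at hD
    rw [Finset.sum_range_succ, ← sub_sub, hG, ← mul_sub] at hD
    have hne1 : (1 - X : ℝ[X]) ≠ 0 := fun h0 => by simpa using congrArg (eval 0) h0
    exact ne_tierPoly hχ hfin hne hG (fun j hj n hn hkn => (hGs j hj n hn hkn).2) hS
      (sub_eq_zero.1 ((mul_eq_zero.1 hD).resolve_left (pow_ne_zero _ hne1)))
  have hSχ : 0 < S * χ 0 := mul_pos hS hχ0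
  refine ⟨fun x hx => ?_, hχ0, fun n r => w n r / (S * χ 0),
    fun n r => div_nonneg (hwnn n r) hSχ.le, fun n r hnr => ?_, ?_, fun x _ => ?_⟩
  · have hlow : S * χ 0 * x ^ N ≤ S * (x - Psi χ h x) := by
      rw [hev x, ← hsum, Finset.sum_mul]
      refine Finset.sum_le_sum fun n hn => ?_
      rw [Finset.sum_mul]
      refine Finset.sum_le_sum fun r hr => mul_le_mul_of_nonneg_left ?_ (hwnn n r)
      exact (pow_le_pow_of_le_one hx.1.le hx.2 (Finset.mem_Icc.1 hn).2).trans
        (pow_le_Bge (Finset.mem_Icc.1 hr).2 hx.1.le hx.2)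
    have hxN : 0 < S * χ 0 * x ^ N := mul_pos hSχ (pow_pos hx.1 N)
    linarith [pos_of_mul_pos_right (hxN.trans_le hlow) hS.le]
  · exact of_decompWeight_ne_zero hχ.1 (div_ne_zero_iff.1 hnr).1
  · simp_rw [← Finset.sum_div]
    rw [hsum, div_self hSχ.ne']
  · simp_rw [div_mul_eq_mul_div, ← Finset.sum_div]
    rw [← hev x]
    field_simp
end
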